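/- There exists ρ_0 > 0 such that for every δ_0 ∈ (0, ρ_0) there exists β > 0 with the following property: for every v ∈ ℝ^n and all x, y ∈ 𝕋^n satisfying δ_0 ≤ dist(x,y) ≤ ρ_0 and dist(y, z) ≥ δ_0 for every z ∈ K, one has dist(f_v(x), f_v(y)) ≥ dist(x,y) + β. -/

import Mathlib

open MeasureTheory Set Filter Topology

noncomputable section

/-- The `n`-torus `𝕋ⁿ = ℝⁿ/ℤⁿ`. -/
abbrev Torus (n : ℕ) : Type := Fin n → AddCircle (1 : ℝ)

/-- The canonical projection `ℝⁿ → 𝕋ⁿ`. -/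
def tproj (n : ℕ) (x : Fin n → ℝ) : Torus n := fun i => (x i : AddCircle (1 : ℝ))

/-- The set of points of `ℝⁿ` where the inverse of the derivative of the lift `F`
has (operator) norm one. Its projection to the torus is the set `K`. -/
def KsetF (n : ℕ) (F : (Fin n → ℝ) → Fin n → ℝ) : Set (Fin n → ℝ) :=
  {x | ‖Ring.inverse (fderiv ℝ F x)‖ = 1}

/-- The hypotheses on `f : 𝕋ⁿ → 𝕋ⁿ`: `f` is a `C^{1+α}` local diffeomorphism with
lift `F`, with `‖Df(x)⁻¹‖ ≤ 1` everywhere, and `K = {‖Df(x)⁻¹‖ = 1}` finite. -/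
structure TorusHyp (n : ℕ) (α : ℝ) (f : Torus n → Torus n)
    (F : (Fin n → ℝ) → Fin n → ℝ) : Prop where
  hn : 1 ≤ n
  hα0 : 0 < α
  hα1 : α ≤ 1
  hlift : ∀ x, f (tproj n x) = tproj n (F x)
  hdiff : Differentiable ℝ F
  hHolder : ∃ C : ℝ, ∀ x y, ‖fderiv ℝ F x - fderiv ℝ F y‖ ≤ C * ‖x - y‖ ^ α
  hunit : ∀ x, IsUnit (fderiv ℝ F x)
  hinvnorm : ∀ x, ‖Ring.inverse (fderiv ℝ F x)‖ ≤ 1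
  hKfin : (tproj n '' KsetF n F).Finite

/-- The basin of an invariant measure. -/
def basin {n : ℕ} (f : Torus n → Torus n) (μ : Measure (Torus n)) : Set (Torus n) :=
  {x | ∀ φ : C(Torus n, ℝ),
    Tendsto (fun N : ℕ => (N : ℝ)⁻¹ * ∑ j ∈ Finset.range N, φ (f^[j] x)) atTop
      (𝓝 (∫ y, φ y ∂μ))}

/-- The (closed) support of a measure on a topological space. -/
def mSupport {Y : Type*} [TopologicalSpace Y] [MeasurableSpace Y] (θ : Measure Y) : Set Y :=
  {t | ∀ U ∈ 𝓝 t, θ U ≠ 0}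

/-- `μ` is a stationary measure for the random system given by the family `g`
of maps of the torus and the noise distribution `θ`. -/
def IsStationaryT {n : ℕ} (g : (Fin n → ℝ) → Torus n → Torus n)
    (θ : Measure (Fin n → ℝ)) (μ : Measure (Torus n)) : Prop :=
  ∀ φ : C(Torus n, ℝ), ∫ x, ∫ v, φ (g v x) ∂θ ∂μ = ∫ x, φ x ∂μ

/-- A map whose derivative varies by at most `1/2` on a ball and is nowhere contracting strictly
increases the distance from the centre, provided the derivative there strictly expands. -/
theorem norm_sub_lt_norm_image_sub {E : Type*} [NormedAddCommGroup E] [NormedSpace ℝ E]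
    [CompleteSpace E] {F : E → E} {e : E → E ≃L[ℝ] E}
    (hF : ∀ x, HasFDerivAt F (e x : E →L[ℝ] E) x)
    (he : ∀ x, ‖((e x).symm : E →L[ℝ] E)‖ ≤ 1) {a b : E} {r : ℝ}
    (hr : ∀ x ∈ Metric.ball b r, ‖(e x : E →L[ℝ] E) - e b‖ ≤ 1 / 2)
    (hb : ‖((e b).symm : E →L[ℝ] E)‖ < 1) (hab : a ≠ b) (har : ‖a - b‖ < r)
    (hFab : ‖F a - F b‖ ≤ r / 4) : ‖a - b‖ < ‖F a - F b‖ := by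
  have hr0 : 0 < r := (norm_nonneg _).trans_lt har
  have hapx : ApproximatesLinearOn F (e b : E →L[ℝ] E) (Metric.ball b r) (1 / 2) := by
    intro x hx y hy
    simpa using (convex_ball b r).norm_image_sub_le_of_norm_hasFDerivWithin_le'
      (fun z _ => (hF z).hasFDerivWithinAt) hr hy hx
  have : Nontrivial E := ⟨a, b, hab⟩
  have hpos : 0 < ‖((e b).symm : E →L[ℝ] E)‖₊ := (e b).nnnorm_symm_pos
  have hinv : 1 ≤ ‖((e b).symm : E →L[ℝ] E)‖₊⁻¹ := (one_le_inv₀ hpos).2 (he b)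
  have hc : Subsingleton E ∨ (1 / 2 : NNReal) < ‖((e b).symm : E →L[ℝ] E)‖₊⁻¹ :=
    Or.inr (lt_of_lt_of_le (by rw [div_lt_one] <;> norm_num) hinv)
  let P := hapx.toOpenPartialHomeomorph F _ hc Metric.isOpen_ball
  have hsource : P.source = Metric.ball b r := rfl
  have htarget : Metric.closedBall (F b) (r / 4) ⊆ P.target := by
    refine subset_trans (Metric.closedBall_subset_closedBall ?_)
      (hapx.closedBall_subset_target hc Metric.isOpen_ball (ε := r / 2) (by positivity)
        (Metric.closedBall_subset_ball (by linarith)))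
    have h1 : (1 : ℝ) ≤ ((‖((e b).symm : E →L[ℝ] E)‖₊⁻¹ : NNReal) : ℝ) := by exact_mod_cast hinv
    have h2 : ((1 / 2 : NNReal) : ℝ) = 1 / 2 := by simp
    rw [h2]
    nlinarith
  have hsymm : ∀ p ∈ P.target, HasFDerivAt P.symm ((e (P.symm p)).symm : E →L[ℝ] E) p :=
    fun p hp => P.hasFDerivAt_symm hp (hF _)
  have hlip : ∀ p ∈ Metric.closedBall (F b) (r / 4), ∀ q ∈ Metric.closedBall (F b) (r / 4),
      ‖P.symm q - P.symm p‖ ≤ ‖q - p‖ := by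
    intro p hp q hq
    simpa using (convex_closedBall (F b) (r / 4)).norm_image_sub_le_of_norm_hasFDerivWithin_le
      (fun z hz => (hsymm z (htarget hz)).hasFDerivWithinAt) (fun z _ => he _) hp hq
  have hbs : b ∈ P.source := by rw [hsource]; exact Metric.mem_ball_self hr0
  have has : a ∈ P.source := by rw [hsource, Metric.mem_ball, dist_eq_norm]; exact har
  have hPb : P.symm (F b) = b := P.left_inv hbs
  have hPa : P.symm (F a) = a := P.left_inv has
  have hw : 0 < ‖F a - F b‖ := by
    rw [norm_pos_iff, sub_ne_zero]
    exact fun h => hab (P.injOn has hbs h)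
  have hball : ∀ t ∈ Icc (0 : ℝ) 1, F b + t • (F a - F b) ∈ Metric.closedBall (F b) (r / 4) := by
    intro t ht
    rw [Metric.mem_closedBall, dist_eq_norm, add_sub_cancel_left, norm_smul, Real.norm_eq_abs,
      abs_of_nonneg ht.1]
    nlinarith [ht.2]
  have hDb := hsymm (F b) (htarget (Metric.mem_closedBall_self (by positivity)))
  rw [hPb] at hDb
  obtain ⟨c, hc1, hc2⟩ := exists_between hb
  have hnear : ∀ᶠ p in 𝓝 (F b), ‖P.symm p - b‖ ≤ c * ‖p - F b‖ := by
    filter_upwards [hDb.isLittleO.def (sub_pos.2 hc1)] with p hp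
    rw [hPb] at hp
    have h1 := ((e b).symm : E →L[ℝ] E).le_opNorm (p - F b)
    have h2 := norm_add_le (P.symm p - b - ((e b).symm : E →L[ℝ] E) (p - F b))
      (((e b).symm : E →L[ℝ] E) (p - F b))
    rw [sub_add_cancel] at h2
    linarith
  have hline : Tendsto (fun t : ℝ => F b + t • (F a - F b)) (𝓝[>] 0) (𝓝 (F b)) := by
    have : Continuous (fun t : ℝ => F b + t • (F a - F b)) := by fun_prop
    simpa using (this.tendsto 0).mono_left nhdsWithin_le_nhds
  obtain ⟨t, ht, ht0, ht1⟩ := ((hline.eventually hnear).and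
    (Ioo_mem_nhdsGT (zero_lt_one' ℝ))).exists
  have hfirst : ‖P.symm (F b + t • (F a - F b)) - b‖ < t * ‖F a - F b‖ := by
    rw [add_sub_cancel_left, norm_smul, Real.norm_eq_abs, abs_of_pos ht0] at ht
    nlinarith [mul_pos ht0 hw]
  have hsecond := hlip _ (hball t ⟨ht0.le, ht1.le⟩) (F a) (by simpa [dist_eq_norm] using hFab)
  have hdiff : F a - (F b + t • (F a - F b)) = (1 - t) • (F a - F b) := by module
  rw [hPa, hdiff, norm_smul, Real.norm_eq_abs, abs_of_pos (sub_pos.2 ht1)] at hsecond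
  have htri := norm_add_le (a - P.symm (F b + t • (F a - F b)))
    (P.symm (F b + t • (F a - F b)) - b)
  rw [sub_add_sub_cancel] at htri
  linarith

theorem isOpenQuotientMap_tproj (n : ℕ) : IsOpenQuotientMap (tproj n) :=
  IsOpenQuotientMap.piMap fun _ => QuotientAddGroup.isOpenQuotientMap_mk

theorem tproj_sub (n : ℕ) (x y : Fin n → ℝ) : tproj n (x - y) = tproj n x - tproj n y := rfl

theorem tproj_add (n : ℕ) (x y : Fin n → ℝ) : tproj n (x + y) = tproj n x + tproj n y := rfl

theorem exists_tproj_eq_norm_eq {n : ℕ} (x : Torus n) :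
    ∃ a : Fin n → ℝ, tproj n a = x ∧ ‖a‖ = ‖x‖ := by
  have h : ∀ t : AddCircle (1 : ℝ), ∃ c : ℝ, (c : AddCircle (1 : ℝ)) = t ∧ ‖c‖ = ‖t‖ := by
    intro t
    obtain ⟨u, rfl⟩ := QuotientAddGroup.mk_surjective t
    refine ⟨u - round u, ?_, UnitAddCircle.norm_eq.symm⟩
    have h1 : ((round u : ℝ) : AddCircle (1 : ℝ)) = 0 := by
      rw [AddCircle.coe_eq_zero_iff]
      exact ⟨round u, by simp⟩
    rw [AddCircle.coe_sub, h1, sub_zero]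
  choose c hc hn using h
  refine ⟨fun i => c (x i), funext fun i => hc _, ?_⟩
  have hn' : ∀ t, ‖c t‖₊ = ‖t‖₊ := fun t => NNReal.coe_injective (hn t)
  simp [Pi.norm_def, hn']

theorem norm_tproj_of_le_half {n : ℕ} {a : Fin n → ℝ} (ha : ‖a‖ ≤ 1 / 2) : ‖tproj n a‖ = ‖a‖ := by
  have h : ∀ i, ‖tproj n a i‖₊ = ‖a i‖₊ := fun i => NNReal.coe_injective <|
    (AddCircle.norm_coe_eq_abs_iff 1 one_ne_zero).2 (by simpa using (norm_le_pi_norm a i).trans ha)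
  simp [Pi.norm_def, h]

theorem norm_torus_le_half {n : ℕ} (x : Torus n) : ‖x‖ ≤ 1 / 2 :=
  (pi_norm_le_iff_of_nonneg (by norm_num)).2 fun i => by
    simpa using AddCircle.norm_le_half_period (1 : ℝ) (x := x i) one_ne_zero

namespace TorusHyp

variable {n : ℕ} {α : ℝ} {f : Torus n → Torus n} {F : (Fin n → ℝ) → Fin n → ℝ}

theorem continuous (hyp : TorusHyp n α f F) : Continuous f := by
  rw [(isOpenQuotientMap_tproj n).isQuotientMap.continuous_iff,
    show f ∘ tproj n = tproj n ∘ F from funext hyp.hlift]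
  exact (isOpenQuotientMap_tproj n).continuous.comp hyp.hdiff.continuous

/-- Nearby points are pushed strictly apart when one of them is outside `K`. -/
theorem exists_dist_lt_dist_image (hyp : TorusHyp n α f F) :
    ∃ ρ > (0 : ℝ), ∀ x y : Torus n, x ≠ y → dist x y ≤ ρ → y ∉ tproj n '' KsetF n F →
      dist x y < dist (f x) (f y) := by
  have hequiv : ∀ x, ∃ e : (Fin n → ℝ) ≃L[ℝ] (Fin n → ℝ),
      (e : (Fin n → ℝ) →L[ℝ] (Fin n → ℝ)) = fderiv ℝ F x ∧
      (e.symm : (Fin n → ℝ) →L[ℝ] (Fin n → ℝ)) = Ring.inverse (fderiv ℝ F x) := by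
    intro x
    obtain ⟨u, hu⟩ := hyp.hunit x
    refine ⟨ContinuousLinearEquiv.ofUnit u, hu, ?_⟩
    rw [← hu, Ring.inverse_unit]
    rfl
  choose e he hes using hequiv
  obtain ⟨C, hC⟩ := hyp.hHolder
  obtain ⟨r, hr0, hr⟩ : ∃ r > (0 : ℝ), ∀ x y, ‖x - y‖ < r →
      ‖fderiv ℝ F x - fderiv ℝ F y‖ ≤ 1 / 2 := by
    have hlim : Tendsto (fun t : ℝ => C * t ^ α) (𝓝 0) (𝓝 0) := by
      have h := ((Real.continuous_rpow_const hyp.hα0.le).tendsto 0).const_mul C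
      simpa [Real.zero_rpow hyp.hα0.ne'] using h
    obtain ⟨r, hr0, hr⟩ := Metric.eventually_nhds_iff.1
      (hlim.eventually (Iic_mem_nhds (show (0 : ℝ) < 1 / 2 by norm_num)))
    exact ⟨r, hr0, fun x y hxy => (hC x y).trans (hr (by simpa using hxy))⟩
  have huc := (isCompact_closedBall (0 : Fin n → ℝ) 1).uniformContinuousOn_of_continuous
    hyp.hdiff.continuous.continuousOn
  obtain ⟨δ, hδ0, hδ⟩ := Metric.uniformContinuousOn_iff.1 huc (min (1 / 2) (r / 4)) (by positivity)
  refine ⟨min (1 / 2) (min (δ / 2) (r / 2)), by positivity, fun x y hxy hd hy => ?_⟩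
  obtain ⟨hd1, hd2, hd3⟩ := (le_min_iff.1 hd).imp_right le_min_iff.1
  obtain ⟨b, rfl, hb⟩ := exists_tproj_eq_norm_eq y
  obtain ⟨w, hw, hwn⟩ := exists_tproj_eq_norm_eq (x - tproj n b)
  obtain rfl : tproj n (w + b) = x := by rw [tproj_add, hw, sub_add_cancel]
  rw [← dist_eq_norm] at hwn
  have hb1 : ‖b‖ ≤ 1 / 2 := hb.trans_le (norm_torus_le_half _)
  have hF : dist (F (w + b)) (F b) < min (1 / 2) (r / 4) := by
    refine hδ _ ?_ _ ?_ ?_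
    · rw [mem_closedBall_zero_iff]
      exact (norm_add_le _ _).trans (by linarith)
    · rw [mem_closedBall_zero_iff]
      linarith
    · rw [dist_eq_norm, add_sub_cancel_right]
      linarith
  rw [dist_eq_norm] at hF
  obtain ⟨hF1, hF2⟩ := lt_min_iff.1 hF
  have hbK : ‖((e b).symm : (Fin n → ℝ) →L[ℝ] (Fin n → ℝ))‖ < 1 := by
    rw [hes]
    exact lt_of_le_of_ne (hyp.hinvnorm b) fun h => hy ⟨b, h, rfl⟩
  have hmain := norm_sub_lt_norm_image_sub (F := F) (e := e) (a := w + b) (b := b) (r := r)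
    (fun x => by rw [he]; exact (hyp.hdiff x).hasFDerivAt)
    (fun x => by rw [hes]; exact hyp.hinvnorm x)
    (fun x hx => by rw [he, he]; exact hr x b (by simpa [dist_eq_norm] using hx))
    hbK (fun h => hxy (by rw [h])) (by rw [add_sub_cancel_right]; linarith) hF2.le
  rw [add_sub_cancel_right, hwn] at hmain
  rwa [hyp.hlift, hyp.hlift, dist_eq_norm (tproj n (F _)), ← tproj_sub,
    norm_tproj_of_le_half hF1.le]

end TorusHyp

/-- uniform gain of distance away from `K`. There is `ρ₀ > 0` such that
for every `δ₀ ∈ (0,ρ₀)` there is `β > 0` with: for every `v ∈ ℝⁿ` and all `x, y` with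
`δ₀ ≤ dist(x,y) ≤ ρ₀` and `y` at distance at least `δ₀` from `K`,
`dist(f_v x, f_v y) ≥ dist(x,y) + β`. -/
theorem expansion_away_from_K
    (n : ℕ) (α : ℝ) (f : Torus n → Torus n) (F : (Fin n → ℝ) → Fin n → ℝ)
    (hyp : TorusHyp n α f F) :
    ∃ ρ₀ > (0 : ℝ), ∀ δ₀ : ℝ, 0 < δ₀ → δ₀ < ρ₀ →
      ∃ β > (0 : ℝ), ∀ (v : Fin n → ℝ) (x y : Torus n),
        δ₀ ≤ dist x y → dist x y ≤ ρ₀ →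
        (∀ z ∈ tproj n '' KsetF n F, δ₀ ≤ dist y z) →
        dist x y + β ≤ dist (f x + tproj n v) (f y + tproj n v) := by
  obtain ⟨ρ, hρ, hlt⟩ := hyp.exists_dist_lt_dist_image
  refine ⟨ρ, hρ, fun δ hδ _ => ?_⟩
  have hf := hyp.continuous
  let S : Set (Torus n × Torus n) := {p | δ ≤ dist p.1 p.2 ∧ dist p.1 p.2 ≤ ρ ∧
    ∀ z ∈ tproj n '' KsetF n F, δ ≤ dist p.2 z}
  have hS : IsCompact S := by
    refine IsClosed.isCompact ?_
    simp only [S, ofPred_and, ofPred_forall]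
    refine IsClosed.inter (isClosed_le (by fun_prop) (by fun_prop))
      (IsClosed.inter (isClosed_le (by fun_prop) (by fun_prop)) ?_)
    exact isClosed_biInter fun z _ => isClosed_le (by fun_prop) (by fun_prop)
  rcases S.eq_empty_or_nonempty with hempty | hne
  · exact ⟨1, one_pos, fun v x y h1 h2 h3 =>
      absurd (show (x, y) ∈ S from ⟨h1, h2, h3⟩) (by simp [hempty])⟩
  · obtain ⟨p, ⟨hp1, hp2, hp3⟩, hmin⟩ := hS.exists_isMinOn hne
      (f := fun p : Torus n × Torus n => dist (f p.1) (f p.2) - dist p.1 p.2)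
      (by fun_prop)
    refine ⟨dist (f p.1) (f p.2) - dist p.1 p.2, sub_pos.2 (hlt _ _ ?_ hp2 ?_),
      fun v x y h1 h2 h3 => ?_⟩
    · exact dist_pos.1 (hδ.trans_le hp1)
    · intro h
      have := hp3 _ h
      rw [dist_self] at this
      linarith
    · have h := isMinOn_iff.1 hmin (x, y) ⟨h1, h2, h3⟩
      rw [dist_add_right]
      linarith
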